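/- For ν > −1, ∫_0^∞ ((t/2)(J_ν²(t) − J_{ν+1}(t)J_{ν−1}(t)) − 1/π) dt = −ν/2. -/

import Mathlib

open Filter

noncomputable section

/-- The Bessel function of the first kind of order `ν`. -/
noncomputable def besselJ (ν : ℝ) (x : ℝ) : ℝ :=
  ∑' k : ℕ, ((-1 : ℝ) ^ k / (Nat.factorial k * Real.Gamma (ν + k + 1))) *
    (x / 2) ^ (2 * (k : ℝ) + ν)

/-- power series coefficients of the entire part of the Bessel function -/
def besC (ν : ℝ) (k : ℕ) : ℝ := (-1 : ℝ) ^ k / (Nat.factorial k * Real.Gamma (ν + k + 1))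

/-- the entire part: `J_ν(x) = (x/2)^ν * besE ν (x²/4)` -/
def besE (ν : ℝ) (z : ℝ) : ℝ := ∑' k : ℕ, besC ν k * z ^ k

lemma bes_gamma_pos {ν : ℝ} (hν : -1 < ν) (k : ℕ) : 0 < Real.Gamma (ν + k + 1) := by
  apply Real.Gamma_pos_of_pos
  have : (0:ℝ) ≤ k := Nat.cast_nonneg k
  linarith

lemma besC_ne {ν : ℝ} (hν : -1 < ν) (k : ℕ) : besC ν k ≠ 0 := by
  unfold besC
  have := bes_gamma_pos hν k
  have h2 : (0:ℝ) < k.factorial := by exact_mod_cast Nat.factorial_pos k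
  apply div_ne_zero
  · exact pow_ne_zero _ (by norm_num)
  · positivity

lemma besC_succ {ν : ℝ} (hν : -1 < ν) (k : ℕ) :
    besC ν (k + 1) = - besC ν k / ((k + 1) * (ν + k + 1)) := by
  unfold besC
  have h := bes_gamma_pos hν k
  have hk : (0:ℝ) ≤ k := Nat.cast_nonneg k
  have h3 : (0:ℝ) < ν + k + 1 := by linarith
  have h2 : (0:ℝ) < k.factorial := by exact_mod_cast Nat.factorial_pos k
  have h4 : ν + ((k + 1 : ℕ) : ℝ) + 1 = (ν + k + 1) + 1 := by push_cast; ring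
  rw [h4, Real.Gamma_add_one h3.ne', Nat.factorial_succ]
  push_cast
  field_simp
  ring

lemma besC_summable {ν : ℝ} (hν : -1 < ν) (z : ℝ) :
    Summable (fun k => |besC ν k * z ^ k|) := by
  by_cases hz : z = 0
  · apply summable_of_ne_finset_zero (s := {0})
    intro k hk
    simp only [Finset.mem_singleton] at hk
    simp [hz, hk]
  apply summable_of_ratio_test_tendsto_lt_one (l := 0) (by norm_num)
  · filter_upwards with k
    exact abs_ne_zero.mpr (mul_ne_zero (besC_ne hν k) (pow_ne_zero _ hz))
  · have h1 : ∀ k : ℕ, ‖|besC ν (k+1) * z ^ (k+1)|‖ / ‖|besC ν k * z ^ k|‖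
        = |z| * (((k:ℝ) + 1)⁻¹ * (ν + k + 1)⁻¹) := by
      intro k
      have hk : (0:ℝ) ≤ k := Nat.cast_nonneg k
      have h3 : (0:ℝ) < ν + k + 1 := by linarith
      have h4 : (0:ℝ) < (k:ℝ) + 1 := by linarith
      rw [Real.norm_eq_abs, Real.norm_eq_abs, abs_abs, abs_abs, besC_succ hν, abs_mul, abs_mul,
        abs_div, abs_neg, abs_mul, abs_of_pos h3, abs_of_pos h4, pow_succ, abs_mul]
      have := abs_pos.mpr (besC_ne hν k)
      have := abs_pos.mpr (pow_ne_zero k hz)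
      field_simp
    simp_rw [h1]
    have t1 : Tendsto (fun k : ℕ => ((k:ℝ) + 1)⁻¹) atTop (nhds 0) :=
      tendsto_inv_atTop_zero.comp (tendsto_atTop_add_const_right _ _ tendsto_natCast_atTop_atTop)
    have t2 : Tendsto (fun k : ℕ => (ν + (k:ℝ) + 1)⁻¹) atTop (nhds 0) :=
      tendsto_inv_atTop_zero.comp (tendsto_atTop_add_const_right _ _
        (tendsto_atTop_add_const_left _ _ tendsto_natCast_atTop_atTop))
    simpa using (t1.mul t2).const_mul |z|

lemma besC_summable' {ν : ℝ} (hν : -1 < ν) (z : ℝ) :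
    Summable (fun k => besC ν k * z ^ k) := (besC_summable hν z).of_abs

lemma besC_deriv {ν : ℝ} (k : ℕ) :
    besC ν (k + 1) * (k + 1) = - besC (ν + 1) k := by
  unfold besC
  have h4 : ν + ((k + 1 : ℕ) : ℝ) + 1 = (ν + 1 + k + 1) := by push_cast; ring
  rw [h4, Nat.factorial_succ]
  have h2 : (0:ℝ) < k.factorial := by exact_mod_cast Nat.factorial_pos k
  have hk : (0:ℝ) < (k:ℝ) + 1 := by positivity
  push_cast
  by_cases h : Real.Gamma (ν + 1 + k + 1) = 0
  · simp [h]
  field_simp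
  ring

lemma besE_hasDerivAt {ν : ℝ} (hν : -1 < ν) (z : ℝ) :
    HasDerivAt (besE ν) (- besE (ν + 1) z) z := by
  set R : ℝ := |z| + 1 with hR
  have hsum : Summable (fun k : ℕ => besC ν k * (k * R ^ (k - 1))) := by
    rw [← summable_nat_add_iff 1]
    have : (fun k : ℕ => besC ν (k+1) * (((k+1 : ℕ):ℝ) * R ^ (k + 1 - 1)))
        = fun k => - (besC (ν+1) k * R ^ k) := by
      ext k
      have := besC_deriv (ν := ν) k
      push_cast; rw [← mul_assoc, this]; ring
    rw [this]
    exact (besC_summable' (by linarith) R).neg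
  have key := hasDerivAt_tsum_of_isPreconnected (u := fun k : ℕ => ‖besC ν k * (k * R ^ (k - 1))‖)
    (t := Metric.ball (0:ℝ) R) (g := fun k w => besC ν k * w ^ k)
    (g' := fun k w => besC ν k * (k * w ^ (k - 1))) (y₀ := z) (y := z)
    hsum.norm Metric.isOpen_ball (convex_ball _ _).isPreconnected
    (fun k w _ => (hasDerivAt_pow k w).const_mul _)
    (fun k w hw => by
      rw [norm_mul, norm_mul, norm_mul, norm_mul]
      have hw' : |w| < R := by simpa using hw
      gcongr
      rw [norm_pow, norm_pow]
      have : ‖w‖ ≤ ‖R‖ := by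
        rw [Real.norm_eq_abs, Real.norm_eq_abs]; exact hw'.le.trans (le_abs_self R)
      gcongr)
    (by simp [hR]) (besC_summable' hν z) (by simp [hR])
  have hz : Summable (fun k : ℕ => besC ν k * (k * z ^ (k - 1))) := by
    rw [← summable_nat_add_iff 1]
    have : (fun k : ℕ => besC ν (k+1) * (((k+1 : ℕ):ℝ) * z ^ (k + 1 - 1)))
        = fun k => - (besC (ν+1) k * z ^ k) := by
      ext k
      have := besC_deriv (ν := ν) k
      push_cast; rw [← mul_assoc, this]; ring
    rw [this]
    exact (besC_summable' (by linarith) z).neg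
  suffices hfin : - besE (ν + 1) z = ∑' k : ℕ, besC ν k * (k * z ^ (k - 1)) by
    rw [hfin]; exact key
  rw [hz.tsum_eq_zero_add]
  simp only [Nat.cast_zero, zero_mul, mul_zero, zero_add]
  rw [besE, ← tsum_neg]
  congr 1
  ext k
  have := besC_deriv (ν := ν) k
  push_cast
  rw [← mul_assoc, this]; ring

lemma besE_continuous {ν : ℝ} (hν : -1 < ν) : Continuous (besE ν) :=
  continuous_iff_continuousAt.mpr fun z => (besE_hasDerivAt hν z).continuousAt

lemma besE_rec {ν : ℝ} (hν : -1 < ν) (z : ℝ) :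
    besE (ν - 1) z = ν * besE ν z - z * besE (ν + 1) z := by
  have hc : ∀ k : ℕ, besC (ν - 1) k = (ν + k) * besC ν k := by
    intro k
    unfold besC
    have h2 : (0:ℝ) < k.factorial := by exact_mod_cast Nat.factorial_pos k
    have e : ν - 1 + k + 1 = ν + k := by ring
    rw [e]
    by_cases h : ν + k = 0
    · rw [h]; simp
    · have hg := bes_gamma_pos hν k
      rw [Real.Gamma_add_one h] at hg ⊢
      have : Real.Gamma (ν + k) ≠ 0 := by
        intro h0; rw [h0] at hg; simp at hg
      field_simp
  have h1 := (besC_summable' hν z).hasSum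
  have h2 : HasSum (fun k : ℕ => (k:ℝ) * besC ν k * z ^ k) (- (z * besE (ν + 1) z)) := by
    rw [← hasSum_nat_add_iff' 1]
    simp only [Finset.range_one, Finset.sum_singleton, Nat.cast_zero, zero_mul, sub_zero]
    have := ((besC_summable' (show -1 < ν + 1 by linarith) z).hasSum.mul_left z).neg
    change HasSum _ (-(z * besE (ν + 1) z)) at this
    refine this.congr_fun ?_
    intro k
    have := besC_deriv (ν := ν) k
    push_cast
    linear_combination z ^ (k+1) * this
  have h3 := (h1.mul_left ν).add h2
  have h4 : ν * besE ν z - z * besE (ν + 1) z =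
      ν * ∑' k : ℕ, besC ν k * z ^ k + -(z * besE (ν + 1) z) := by
    rw [sub_eq_add_neg]; rfl
  rw [h4, ← h3.tsum_eq, besE]
  congr 1
  ext k
  rw [hc]; ring

lemma besselJ_eq {ν x : ℝ} (hx : 0 < x) : besselJ ν x = (x / 2) ^ ν * besE ν (x ^ 2 / 4) := by
  unfold besselJ besE besC
  rw [← tsum_mul_left]
  congr 1
  ext k
  have h : 0 < x / 2 := by positivity
  rw [Real.rpow_add h, mul_comm (2:ℝ), Real.rpow_mul h.le, Real.rpow_natCast]
  have : x ^ 2 / 4 = (x / 2) ^ 2 := by ring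
  rw [this, ← pow_mul, mul_comm 2 k, pow_mul]
  norm_cast
  ring

lemma besselJ_rec {ν x : ℝ} (hν : -1 < ν) (hx : 0 < x) :
    besselJ (ν - 1) x = 2 * ν / x * besselJ ν x - besselJ (ν + 1) x := by
  have h : 0 < x / 2 := by positivity
  rw [besselJ_eq hx, besselJ_eq hx, besselJ_eq hx, besE_rec hν, Real.rpow_sub_one h.ne',
    Real.rpow_add_one h.ne']
  field_simp
  ring

lemma besselJ_hasDerivAt {ν x : ℝ} (hν : -1 < ν) (hx : 0 < x) :
    HasDerivAt (besselJ ν) (ν / x * besselJ ν x - besselJ (ν + 1) x) x := by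
  have h : 0 < x / 2 := by positivity
  have h1 : HasDerivAt (fun y : ℝ => (y / 2) ^ ν * besE ν (y ^ 2 / 4))
      (ν / x * besselJ ν x - besselJ (ν + 1) x) x := by
    have d1 : HasDerivAt (fun y : ℝ => (y/2) ^ ν) _ x :=
      ((hasDerivAt_id x).div_const 2).rpow_const (Or.inl h.ne')
    have d2 : HasDerivAt (fun y : ℝ => y ^ 2 / 4) (x / 2) x := by
      convert! (hasDerivAt_pow 2 x).div_const 4 using 1
      norm_num; ring
    have d3 : HasDerivAt (fun y : ℝ => besE ν (y ^ 2 / 4)) _ x :=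
      HasDerivAt.comp (h₂ := besE ν) (h := fun y : ℝ => y ^ 2 / 4) x
        (besE_hasDerivAt hν (x ^ 2 / 4)) d2
    convert! d1.mul d3 using 1
    rw [besselJ_eq hx, besselJ_eq hx, Real.rpow_add_one h.ne']
    simp only [id]
    rw [Real.rpow_sub_one h.ne']
    field_simp
    ring
  apply h1.congr_of_eventuallyEq
  filter_upwards [lt_mem_nhds hx] with y hy
  exact besselJ_eq hy

lemma besselJ_hasDerivAt' {ν x : ℝ} (hν : -1 < ν) (hx : 0 < x) :
    HasDerivAt (besselJ (ν + 1)) (besselJ ν x - (ν + 1) / x * besselJ (ν + 1) x) x := by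
  have h := besselJ_hasDerivAt (ν := ν + 1) (by linarith) hx
  have h2 := besselJ_rec (ν := ν + 1) (by linarith) hx
  rw [add_sub_cancel_right] at h2
  convert h using 1
  rw [h2]
  ring

lemma bes_rate {f f' : ℝ → ℝ} {t0 K C : ℝ} (ht0 : 0 < t0)
    (hf : ∀ t, t0 ≤ t → HasDerivAt f (f' t) t)
    (hb : ∀ t, t0 ≤ t → |f' t| ≤ K / t ^ 3) (hC : Tendsto f atTop (nhds C)) :
    ∀ t, t0 ≤ t → |f t - C| ≤ K / (2 * t ^ 2) := by
  have hq : ∀ t : ℝ, t0 ≤ t → HasDerivAt (fun t : ℝ => K / (2 * t ^ 2)) (-(K / t ^ 3)) t := by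
    intro t ht
    have ht' : 0 < t := ht0.trans_le ht
    have := (((hasDerivAt_pow 2 t).const_mul 2).inv (by positivity)).const_mul K
    convert! this using 1
    · field_simp
      push_cast
      norm_num
      ring
  have hlim : Tendsto (fun t : ℝ => K / (2 * t ^ 2)) atTop (nhds 0) := by
    apply Tendsto.div_atTop tendsto_const_nhds
    exact (tendsto_pow_atTop (by norm_num)).const_mul_atTop (by norm_num)
  have anti : AntitoneOn (fun t => f t + K / (2 * t ^ 2)) (Set.Ici t0) := by
    apply antitoneOn_of_deriv_nonpos (convex_Ici t0)
    · intro t ht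
      exact ((hf t ht).add (hq t ht)).continuousAt.continuousWithinAt
    · intro t ht
      rw [interior_Ici] at ht
      exact ((hf t (le_of_lt ht)).add (hq t (le_of_lt ht))).differentiableAt.differentiableWithinAt
    · intro t ht
      rw [interior_Ici] at ht
      have h1 := ((hf t (le_of_lt ht)).add (hq t (le_of_lt ht))).deriv
      have h2 := (abs_le.mp (hb t (le_of_lt ht))).2
      change deriv (f + fun t => K / (2 * t ^ 2)) t ≤ 0
      rw [h1]; linarith
  have mono : MonotoneOn (fun t => f t - K / (2 * t ^ 2)) (Set.Ici t0) := by
    apply monotoneOn_of_deriv_nonneg (convex_Ici t0)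
    · intro t ht
      exact ((hf t ht).sub (hq t ht)).continuousAt.continuousWithinAt
    · intro t ht
      rw [interior_Ici] at ht
      exact ((hf t (le_of_lt ht)).sub (hq t (le_of_lt ht))).differentiableAt.differentiableWithinAt
    · intro t ht
      rw [interior_Ici] at ht
      have h1 := ((hf t (le_of_lt ht)).sub (hq t (le_of_lt ht))).deriv
      have h2 := (abs_le.mp (hb t (le_of_lt ht))).1
      change 0 ≤ deriv (f - fun t => K / (2 * t ^ 2)) t
      rw [h1]; linarith
  intro t ht
  rw [abs_le]
  have l1 : C ≤ f t + K / (2 * t ^ 2) := by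
    have : Tendsto (fun t => f t + K / (2 * t ^ 2)) atTop (nhds C) := by simpa using hC.add hlim
    apply le_of_tendsto this
    filter_upwards [eventually_ge_atTop t] with s hs
    exact anti ht (ht.trans hs) hs
  have l2 : f t - K / (2 * t ^ 2) ≤ C := by
    have : Tendsto (fun t => f t - K / (2 * t ^ 2)) atTop (nhds C) := by simpa using hC.sub hlim
    apply ge_of_tendsto this
    filter_upwards [eventually_ge_atTop t] with s hs
    exact mono ht (ht.trans hs) hs
  constructor <;> linarith

lemma bes_asymp {ν : ℝ} {a b : ℝ → ℝ}
    (ha : ∀ t, 0 < t → HasDerivAt a (ν / t * a t - b t) t)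
    (hb : ∀ t, 0 < t → HasDerivAt b (a t - (ν + 1) / t * b t) t) :
    ∃ C : ℝ, Tendsto (fun t => t * (a t ^ 2 + b t ^ 2)) atTop (nhds C) ∧
      Tendsto (fun t => t * (t * (a t ^ 2 + b t ^ 2) - (2 * ν + 1) * (a t * b t) - C)) atTop
        (nhds 0) ∧ Tendsto a atTop (nhds 0) ∧ Tendsto b atTop (nhds 0) := by
  set κ : ℝ := 2 * ν + 1 with hκ
  set M : ℝ → ℝ := fun t => t * (a t ^ 2 + b t ^ 2) with hM
  set N : ℝ → ℝ := fun t => M t - κ * (a t * b t) with hN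
  have hN' : ∀ t, 0 < t → HasDerivAt N (κ * (a t * b t) / t) t := by
    intro t ht
    have h1 := ((hasDerivAt_id t).mul (((ha t ht).pow 2).add ((hb t ht).pow 2))).sub
      (((ha t ht).mul (hb t ht)).const_mul κ)
    convert! h1 using 1
    simp only [id, Pi.add_apply, Pi.pow_apply]
    rw [hκ]
    field_simp
    push_cast
    ring
  set t0 : ℝ := |κ| + 1 with ht0
  have ht0p : 0 < t0 := by positivity
  have hMnn : ∀ t, 0 < t → 0 ≤ M t := fun t ht => by simp only [hM]; positivity
  have hab : ∀ t, 0 < t → |a t * b t| ≤ M t / (2 * t) := by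
    intro t ht
    have : M t / (2 * t) = (a t ^ 2 + b t ^ 2) / 2 := by simp only [hM]; field_simp
    rw [this, abs_le]
    constructor <;> nlinarith [sq_nonneg (a t + b t), sq_nonneg (a t - b t)]
  have hMN : ∀ t, t0 ≤ t → M t ≤ 2 * N t := by
    intro t ht
    have htp := ht0p.trans_le ht
    have h1 := hab t htp
    have h2 : |κ * (a t * b t)| ≤ M t / 2 := by
      rw [abs_mul]
      calc |κ| * |a t * b t| ≤ t * (M t / (2 * t)) := by
            have : |κ| ≤ t := by linarith
            gcongr
        _ = M t / 2 := by field_simp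
    have := (abs_le.mp h2).2
    simp only [hN]; linarith
  have hexp : ∀ t : ℝ, 0 < t → HasDerivAt (fun t : ℝ => Real.exp (|κ| / t))
      (Real.exp (|κ| / t) * (-(|κ| / t ^ 2))) t := by
    intro t ht
    have := ((hasDerivAt_inv ht.ne').const_mul |κ|).exp
    convert! this using 1
    field_simp
  have anti : AntitoneOn (fun t => N t * Real.exp (|κ| / t)) (Set.Ici t0) := by
    apply antitoneOn_of_deriv_nonpos (convex_Ici t0)
    · intro t ht
      have htp := ht0p.trans_le ht
      exact ((hN' t htp).mul (hexp t htp)).continuousAt.continuousWithinAt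
    · intro t ht
      rw [interior_Ici] at ht
      have htp := ht0p.trans ht
      exact ((hN' t htp).mul (hexp t htp)).differentiableAt.differentiableWithinAt
    · intro t ht
      rw [interior_Ici] at ht
      have htp := ht0p.trans ht
      have h1 := ((hN' t htp).mul (hexp t htp)).deriv
      change deriv (N * fun t => Real.exp (|κ| / t)) t ≤ 0
      rw [h1]
      have h2 : κ * (a t * b t) / t ≤ |κ| * N t / t ^ 2 := by
        calc κ * (a t * b t) / t ≤ |κ * (a t * b t)| / t := by gcongr; exact le_abs_self _
          _ = |κ| * |a t * b t| / t := by rw [abs_mul]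
          _ ≤ |κ| * (M t / (2 * t)) / t := by gcongr; exact hab t htp
          _ ≤ |κ| * (2 * N t / (2 * t)) / t := by gcongr; exact hMN t (le_of_lt ht)
          _ = |κ| * N t / t ^ 2 := by field_simp
      have h3 := Real.exp_pos (|κ| / t)
      have : κ * (a t * b t) / t * Real.exp (|κ| / t) + N t * (Real.exp (|κ| / t) * -(|κ| / t ^ 2))
        = Real.exp (|κ| / t) * (κ * (a t * b t) / t - |κ| * N t / t ^ 2) := by ring
      rw [this]
      apply mul_nonpos_of_nonneg_of_nonpos h3.le
      linarith
  have hNnn : ∀ t, t0 ≤ t → 0 ≤ N t := by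
    intro t ht
    have := hMN t ht
    have := hMnn t (ht0p.trans_le ht)
    linarith
  obtain ⟨C, hC⟩ : ∃ C, Tendsto (fun t => N t * Real.exp (|κ| / t)) atTop (nhds C) := by
    have h1 : Antitone (fun t => N (max t t0) * Real.exp (|κ| / (max t t0))) := by
      intro s t hst
      exact anti (Set.mem_Ici.mpr (le_max_right _ _)) (Set.mem_Ici.mpr (le_max_right _ _)) (max_le_max hst le_rfl)
    have h2 := tendsto_atTop_ciInf h1 ⟨0, by
      rintro _ ⟨t, rfl⟩
      exact mul_nonneg (hNnn _ (le_max_right _ _)) (Real.exp_pos _).le⟩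
    refine ⟨_, h2.congr' ?_⟩
    filter_upwards [eventually_ge_atTop t0] with t ht
    simp only [max_eq_left ht]
  have hNC : Tendsto N atTop (nhds C) := by
    have e : Tendsto (fun t : ℝ => Real.exp (-(|κ| / t))) atTop (nhds 1) := by
      have : Tendsto (fun t : ℝ => -(|κ| / t)) atTop (nhds 0) := by
        simpa using (tendsto_const_nhds (x := |κ|)).div_atTop tendsto_id |>.neg
      have h := (Real.continuous_exp.tendsto 0).comp this
      rw [Real.exp_zero] at h
      exact h
    have := hC.mul e
    rw [mul_one] at this
    refine this.congr ?_
    intro t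
    rw [mul_assoc, ← Real.exp_add]; simp
  obtain ⟨B, t1, hB⟩ : ∃ B t1 : ℝ, ∀ t, t1 ≤ t → N t ≤ B := by
    have := hNC.eventually (gt_mem_nhds (lt_add_one C))
    obtain ⟨t1, h1⟩ := eventually_atTop.mp this
    exact ⟨C + 1, t1, fun t ht => (h1 t ht).le⟩
  set T : ℝ := max t0 t1 with hT
  have hTp : 0 < T := ht0p.trans_le (le_max_left _ _)
  have hMB : ∀ t, T ≤ t → M t ≤ 2 * B := fun t ht => by
    have h1 := hMN t ((le_max_left _ _).trans ht)
    have h2 := hB t ((le_max_right _ _).trans ht)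
    linarith
  have hsq : ∀ t, T ≤ t → a t ^ 2 ≤ 2 * B / t ∧ b t ^ 2 ≤ 2 * B / t := by
    intro t ht
    have htp := hTp.trans_le ht
    have h1 := hMB t ht
    simp only [hM] at h1
    constructor
    · rw [le_div_iff₀ htp]; nlinarith [sq_nonneg (b t)]
    · rw [le_div_iff₀ htp]; nlinarith [sq_nonneg (a t)]
  have hlimB : Tendsto (fun t : ℝ => 2 * B / t) atTop (nhds 0) :=
    tendsto_const_nhds.div_atTop tendsto_id
  have ha2 : Tendsto (fun t => a t ^ 2) atTop (nhds 0) := by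
    refine tendsto_of_tendsto_of_tendsto_of_le_of_le' tendsto_const_nhds hlimB ?_ ?_
    · filter_upwards with t using sq_nonneg _
    · filter_upwards [eventually_ge_atTop T] with t ht using (hsq t ht).1
  have hb2 : Tendsto (fun t => b t ^ 2) atTop (nhds 0) := by
    refine tendsto_of_tendsto_of_tendsto_of_le_of_le' tendsto_const_nhds hlimB ?_ ?_
    · filter_upwards with t using sq_nonneg _
    · filter_upwards [eventually_ge_atTop T] with t ht using (hsq t ht).2
  have root : ∀ f : ℝ → ℝ, Tendsto (fun t => f t ^ 2) atTop (nhds 0) → Tendsto f atTop (nhds 0) := by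
    intro f hf
    rw [tendsto_zero_iff_abs_tendsto_zero]
    have := (Real.continuous_sqrt.tendsto 0).comp hf
    rw [Real.sqrt_zero] at this
    refine this.congr ?_
    intro t; simp [Real.sqrt_sq_eq_abs]
  have ha0 := root a ha2
  have hb0 := root b hb2
  refine ⟨C, ?_, ?_, ha0, hb0⟩
  · have := hNC.add ((ha0.mul hb0).const_mul κ)
    simp only [mul_zero, add_zero] at this
    refine this.congr ?_
    intro t; simp only [hN]; ring
  · set P : ℝ → ℝ := fun t => N t + κ * a t ^ 2 / (2 * t) with hP
    have hP' : ∀ t, T ≤ t → HasDerivAt P (κ * (ν - 1 / 2) * a t ^ 2 / t ^ 2) t := by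
      intro t ht
      have htp := hTp.trans_le ht
      have h1 := (hN' t htp).add ((((ha t htp).pow 2).const_mul κ).div
        ((hasDerivAt_id t).const_mul 2) (by simp only [id]; positivity))
      convert! h1 using 1
      simp only [id, Pi.pow_apply]
      rw [hκ]
      field_simp
      push_cast
      ring
    have hPC : Tendsto P atTop (nhds C) := by
      have : Tendsto (fun t : ℝ => κ * a t ^ 2 / (2 * t)) atTop (nhds 0) := by
        apply Tendsto.div_atTop (ha2.const_mul κ)
        exact tendsto_id.const_mul_atTop (by norm_num)
      simpa using hNC.add this
    have hr := bes_rate hTp hP' (K := |κ * (ν - 1/2)| * (2 * B)) (fun t ht => by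
      have htp := hTp.trans_le ht
      rw [abs_div, abs_mul, abs_of_nonneg (sq_nonneg (a t)), abs_of_pos (by positivity : 0 < t ^ 2)]
      have := (hsq t ht).1
      calc |κ * (ν - 1/2)| * a t ^ 2 / t ^ 2 ≤ |κ * (ν - 1/2)| * (2 * B / t) / t ^ 2 := by gcongr
        _ = _ := by field_simp) hPC
    set K := |κ * (ν - 1/2)| * (2 * B) with hK
    have h2 : Tendsto (fun t => t * (P t - C)) atTop (nhds 0) := by
      have hl : Tendsto (fun t : ℝ => (K / 2) / t) atTop (nhds 0) :=
        tendsto_const_nhds.div_atTop tendsto_id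
      apply squeeze_zero_norm' _ hl
      filter_upwards [eventually_ge_atTop T] with t ht
      have htp := hTp.trans_le ht
      rw [Real.norm_eq_abs, abs_mul, abs_of_pos htp]
      calc t * |P t - C| ≤ t * (K / (2 * t ^ 2)) := by gcongr; exact hr t ht
        _ = _ := by field_simp
    have h3 := h2.sub (ha2.const_mul (κ / 2))
    simp only [mul_zero, sub_zero] at h3
    refine h3.congr' ?_
    filter_upwards [eventually_gt_atTop 0] with t ht
    simp only [hP, hN, hM]
    field_simp
    ring

lemma bes_gamma_desc (x : ℝ) (n : ℕ) (h : 0 < x - n + 1) :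
    Real.Gamma (x + 1) = (descPochhammer ℤ n).smeval x * Real.Gamma (x - n + 1) := by
  induction n with
  | zero => simp
  | succ n ih =>
    push_cast at h
    have h1 : 0 < x - n := by linarith
    rw [ih (by linarith), descPochhammer_succ_right, Polynomial.smeval_mul, Polynomial.smeval_sub,
      Polynomial.smeval_X, Polynomial.smeval_natCast, Real.Gamma_add_one h1.ne']
    push_cast
    have : x - (n + 1) + 1 = x - n := by ring
    rw [this]
    simp
    ring

/-- coefficients of the square of `besE` -/
def besQ (μ : ℝ) (k : ℕ) : ℝ :=
  (-1 : ℝ) ^ k * Real.Gamma (2 * μ + 2 * k + 1) /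
    (Nat.factorial k * Real.Gamma (2 * μ + k + 1) * Real.Gamma (μ + k + 1) ^ 2)

lemma besC_conv {μ : ℝ} (hμ : 0 < μ) (k : ℕ) :
    ∑ ij ∈ Finset.HasAntidiagonal.antidiagonal k, besC μ ij.1 * besC μ ij.2 = besQ μ k := by
  have hV := Ring.descPochhammer_smeval_add (r := μ + k) (s := μ + k) k (Commute.all _ _)
  have hk0 : (0:ℝ) ≤ k := Nat.cast_nonneg k
  have h1 := bes_gamma_desc (μ + k + (μ + k)) k (by linarith)
  have e1 : μ + k + (μ + k) + 1 = 2 * μ + 2 * k + 1 := by ring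
  have e2 : μ + k + (μ + k) - k + 1 = 2 * μ + k + 1 := by ring
  rw [e1, e2] at h1
  have g1 : 0 < Real.Gamma (2 * μ + k + 1) := Real.Gamma_pos_of_pos (by linarith)
  have g2 : 0 < Real.Gamma (μ + k + 1) := Real.Gamma_pos_of_pos (by linarith)
  have f1 : (0:ℝ) < k.factorial := by exact_mod_cast Nat.factorial_pos k
  have hq : besQ μ k = (-1 : ℝ) ^ k * (descPochhammer ℤ k).smeval (μ + k + (μ + k)) /
      (k.factorial * Real.Gamma (μ + k + 1) ^ 2) := by
    unfold besQ; rw [h1]; field_simp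
  rw [hq, hV, Finset.mul_sum, Finset.sum_div]
  apply Finset.sum_congr rfl
  rintro ⟨i, j⟩ hij
  rw [Finset.HasAntidiagonal.mem_antidiagonal] at hij
  simp only at hij ⊢
  subst hij
  have hi : (0:ℝ) ≤ i := Nat.cast_nonneg i
  have hj : (0:ℝ) ≤ j := Nat.cast_nonneg j
  have d1 := bes_gamma_desc (μ + ((i + j : ℕ):ℝ)) i (by push_cast; linarith)
  have d2 := bes_gamma_desc (μ + ((i + j : ℕ):ℝ)) j (by push_cast; linarith)
  have e3 : μ + ((i + j : ℕ):ℝ) - i + 1 = μ + j + 1 := by push_cast; ring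
  have e4 : μ + ((i + j : ℕ):ℝ) - j + 1 = μ + i + 1 := by push_cast; ring
  rw [e3] at d1
  rw [e4] at d2
  have g3 : 0 < Real.Gamma (μ + i + 1) := Real.Gamma_pos_of_pos (by linarith)
  have g4 : 0 < Real.Gamma (μ + j + 1) := Real.Gamma_pos_of_pos (by linarith)
  have hch : ((i + j).choose i : ℝ) * i.factorial * j.factorial = (i + j).factorial := by
    have := Nat.choose_mul_factorial_mul_factorial (Nat.le_add_right i j)
    rw [Nat.add_sub_cancel_left] at this
    exact_mod_cast this
  have f2 : (0:ℝ) < i.factorial := by exact_mod_cast Nat.factorial_pos i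
  have f3 : (0:ℝ) < j.factorial := by exact_mod_cast Nat.factorial_pos j
  have hsq : Real.Gamma (μ + ((i + j : ℕ):ℝ) + 1) ^ 2 =
      ((descPochhammer ℤ i).smeval (μ + ((i + j : ℕ):ℝ)) * Real.Gamma (μ + j + 1)) *
      ((descPochhammer ℤ j).smeval (μ + ((i + j : ℕ):ℝ)) * Real.Gamma (μ + i + 1)) := by
    rw [← d1, ← d2]; ring
  have p1 : (descPochhammer ℤ i).smeval (μ + ((i + j : ℕ):ℝ)) ≠ 0 := by
    intro h0; rw [h0, zero_mul] at d1; exact g2.ne' d1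
  have p2 : (descPochhammer ℤ j).smeval (μ + ((i + j : ℕ):ℝ)) ≠ 0 := by
    intro h0; rw [h0, zero_mul] at d2; exact g2.ne' d2
  have c1 : (0:ℝ) < (i + j).choose i := by
    exact_mod_cast Nat.choose_pos (Nat.le_add_right i j)
  rw [hsq, ← hch, pow_add]
  unfold besC
  field_simp

lemma besE_sq {μ : ℝ} (hμ : 0 < μ) (z : ℝ) :
    HasSum (fun k => besQ μ k * z ^ k) (besE μ z ^ 2) := by
  have hs := besC_summable (ν := μ) (by linarith) z
  have hs : Summable (fun k => ‖besC μ k * z ^ k‖) := hs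
  have h1 := (summable_norm_sum_mul_antidiagonal_of_summable_norm hs hs).of_norm.hasSum
  rw [← tsum_mul_tsum_eq_tsum_sum_antidiagonal_of_summable_norm hs hs] at h1
  have e : besE μ z ^ 2 = (∑' k, besC μ k * z ^ k) * ∑' k, besC μ k * z ^ k := by
    rw [sq]; rfl
  rw [e]
  refine h1.congr_fun ?_
  intro k
  rw [← besC_conv hμ, Finset.sum_mul]
  apply Finset.sum_congr rfl
  rintro ⟨i, j⟩ hij
  rw [Finset.HasAntidiagonal.mem_antidiagonal] at hij
  simp only at hij ⊢
  rw [← hij, pow_add]; ring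

open MeasureTheory Set in
lemma bes_beta {α β : ℝ} (hα : 0 < α) (hβ : 0 < β) :
    IntegrableOn (fun u : ℝ => u ^ (α - 1) * (1 - u) ^ (β - 1)) (Ioo 0 1) ∧
    ∫ u in Ioo (0:ℝ) 1, u ^ (α - 1) * (1 - u) ^ (β - 1) =
      Real.Gamma α * Real.Gamma β / Real.Gamma (α + β) := by
  have hB : 0 < ProbabilityTheory.beta α β := ProbabilityTheory.beta_pos hα hβ
  have h1 := ProbabilityTheory.lintegral_betaPDF_eq_one hα hβ
  rw [ProbabilityTheory.lintegral_betaPDF] at h1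
  have h2 : ∫ u in Ioo (0:ℝ) 1,
      1 / ProbabilityTheory.beta α β * u ^ (α - 1) * (1 - u) ^ (β - 1) = 1 := by
    rw [integral_eq_lintegral_of_nonneg_ae, h1]
    · simp
    · filter_upwards [ae_restrict_mem measurableSet_Ioo] with u hu
      have := hu.1
      have : 0 < 1 - u := by linarith [hu.2]
      simp only [Pi.zero_apply]
      positivity
    · apply Measurable.aestronglyMeasurable
      fun_prop
  have h3 : ∫ u in Ioo (0:ℝ) 1, u ^ (α - 1) * (1 - u) ^ (β - 1) = ProbabilityTheory.beta α β := by
    simp_rw [mul_assoc] at h2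
    rw [integral_const_mul] at h2
    field_simp at h2
    exact h2
  refine ⟨?_, h3⟩
  apply Integrable.of_integral_ne_zero
  rw [h3]; exact hB.ne'

open MeasureTheory Set in
lemma bes_beta_k {μ : ℝ} (hμ : 0 < μ) (k : ℕ) :
    IntegrableOn (fun u : ℝ => u ^ k * (u ^ (μ - 1/2) * (1 - u) ^ (μ - 1/2))) (Ioo 0 1) ∧
    ∫ u in Ioo (0:ℝ) 1, u ^ k * (u ^ (μ - 1/2) * (1 - u) ^ (μ - 1/2)) =
      Real.Gamma (μ + k + 1/2) * Real.Gamma (μ + 1/2) / Real.Gamma (2 * μ + k + 1) := by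
  have hk0 : (0:ℝ) ≤ k := Nat.cast_nonneg k
  have h := bes_beta (α := μ + k + 1/2) (β := μ + 1/2) (by linarith) (by linarith)
  have e : ∀ u ∈ Ioo (0:ℝ) 1, u ^ (μ + k + 1/2 - 1) * (1 - u) ^ (μ + 1/2 - 1) =
      u ^ k * (u ^ (μ - 1/2) * (1 - u) ^ (μ - 1/2)) := by
    intro u hu
    have e1 : μ + k + 1/2 - 1 = k + (μ - 1/2) := by ring
    have e2 : μ + 1/2 - 1 = μ - 1/2 := by ring
    rw [e1, e2, Real.rpow_add hu.1, Real.rpow_natCast]; ring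
  have e3 : μ + k + 1/2 + (μ + 1/2) = 2 * μ + k + 1 := by ring
  rw [e3] at h
  rw [← setIntegral_congr_fun measurableSet_Ioo e]
  exact ⟨h.1.congr_fun e measurableSet_Ioo, h.2⟩

open MeasureTheory Set in
lemma bes_beta_le {μ : ℝ} (hμ : 0 < μ) (k : ℕ) :
    ∫ u in Ioo (0:ℝ) 1, u ^ k * (u ^ (μ - 1/2) * (1 - u) ^ (μ - 1/2)) ≤
    ∫ u in Ioo (0:ℝ) 1, u ^ 0 * (u ^ (μ - 1/2) * (1 - u) ^ (μ - 1/2)) := by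
  apply setIntegral_mono_on (bes_beta_k hμ k).1 (bes_beta_k hμ 0).1 measurableSet_Ioo
  intro u hu
  have h0 := hu.1
  have h1 : 0 < 1 - u := by linarith [hu.2]
  rw [pow_zero]
  gcongr
  exact pow_le_one₀ h0.le hu.2.le

open MeasureTheory Set in
lemma bes_exp_beta {μ x : ℝ} (hμ : 0 < μ) (hx : 0 < x) :
    HasSum (fun k : ℕ => (-x) ^ k / k.factorial *
      ∫ u in Ioo (0:ℝ) 1, u ^ k * (u ^ (μ - 1/2) * (1 - u) ^ (μ - 1/2)))
      (∫ u in Ioo (0:ℝ) 1, Real.exp (-(x * u)) * (u ^ (μ - 1/2) * (1 - u) ^ (μ - 1/2))) := by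
  have h := hasSum_integral_of_summable_integral_norm (μ := volume.restrict (Ioo (0:ℝ) 1))
    (F := fun (k : ℕ) u => (-x) ^ k / k.factorial *
      (u ^ k * (u ^ (μ - 1/2) * (1 - u) ^ (μ - 1/2))))
    (fun k => (bes_beta_k hμ k).1.const_mul _) (by
      have hb : Summable (fun k : ℕ => x ^ k / k.factorial *
        ∫ u in Ioo (0:ℝ) 1, u ^ 0 * (u ^ (μ - 1/2) * (1 - u) ^ (μ - 1/2))) :=
        (Real.summable_pow_div_factorial x).mul_right _
      refine Summable.of_nonneg_of_le (fun k => integral_nonneg fun u => norm_nonneg _) ?_ hb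
      intro k
      have : ∫ u in Ioo (0:ℝ) 1, ‖(-x) ^ k / k.factorial *
          (u ^ k * (u ^ (μ - 1/2) * (1 - u) ^ (μ - 1/2)))‖ = x ^ k / k.factorial *
          ∫ u in Ioo (0:ℝ) 1, u ^ k * (u ^ (μ - 1/2) * (1 - u) ^ (μ - 1/2)) := by
        rw [← integral_const_mul]
        apply setIntegral_congr_fun measurableSet_Ioo
        intro u hu
        have h0 := hu.1
        have h1 : 0 < 1 - u := by linarith [hu.2]
        simp only
        rw [norm_mul, norm_div, norm_pow, norm_neg, Real.norm_of_nonneg hx.le,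
          Real.norm_of_nonneg (by positivity : (0:ℝ) ≤ k.factorial),
          Real.norm_of_nonneg (by positivity)]
      rw [this]
      have := bes_beta_le hμ k
      gcongr)
  have e : ∫ u in Ioo (0:ℝ) 1, ∑' k : ℕ, (-x) ^ k / k.factorial *
      (u ^ k * (u ^ (μ - 1/2) * (1 - u) ^ (μ - 1/2))) =
      ∫ u in Ioo (0:ℝ) 1, Real.exp (-(x * u)) * (u ^ (μ - 1/2) * (1 - u) ^ (μ - 1/2)) := by
    apply setIntegral_congr_fun measurableSet_Ioo
    intro u hu
    simp only
    rw [Real.exp_eq_exp_ℝ, NormedSpace.exp_eq_tsum_div, ← tsum_mul_right]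
    congr 1
    ext k
    rw [← neg_mul, mul_pow]; ring
  rw [e] at h
  refine h.congr_fun ?_
  intro k
  rw [integral_const_mul]

open MeasureTheory Set in
lemma bes_moment {q x : ℝ} (hq : -1 < q) (hx : 0 < x) :
    IntegrableOn (fun t : ℝ => t ^ q * Real.exp (-(1 / x) * t ^ (2:ℝ))) (Ioi 0) ∧
    ∫ t in Ioi (0:ℝ), t ^ q * Real.exp (-(1 / x) * t ^ (2:ℝ)) =
      x ^ ((q + 1) / 2) * (1 / 2) * Real.Gamma ((q + 1) / 2) := by
  have h := integral_rpow_mul_exp_neg_mul_rpow (p := 2) (q := q) (b := 1 / x) (by norm_num) hq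
    (by positivity)
  have e : (1 / x) ^ (-(q + 1) / 2) = x ^ ((q + 1) / 2) := by
    rw [one_div, Real.inv_rpow hx.le, ← Real.rpow_neg hx.le]; congr 1; ring
  rw [e] at h
  refine ⟨?_, h⟩
  apply Integrable.of_integral_ne_zero
  rw [h]
  have := Real.Gamma_pos_of_pos (by linarith : 0 < (q + 1) / 2)
  positivity

lemma bes_coef {μ x : ℝ} (hμ : 0 < μ) (hx : 0 < x) (k : ℕ) :
    besQ μ k * (1 / 4) ^ (μ + k) * (x ^ ((2 * μ + 2 * k + 1 + 1) / 2) * (1 / 2) *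
      Real.Gamma ((2 * μ + 2 * k + 1 + 1) / 2)) =
    x ^ (μ + 1) / (2 * √Real.pi * Real.Gamma (μ + 1/2)) * ((-x) ^ k / k.factorial *
      (Real.Gamma (μ + k + 1/2) * Real.Gamma (μ + 1/2) / Real.Gamma (2 * μ + k + 1))) := by
  have hk0 : (0:ℝ) ≤ k := Nat.cast_nonneg k
  have g1 : 0 < Real.Gamma (2 * μ + k + 1) := Real.Gamma_pos_of_pos (by linarith)
  have g2 : 0 < Real.Gamma (μ + k + 1) := Real.Gamma_pos_of_pos (by linarith)
  have g3 : 0 < Real.Gamma (μ + 1/2) := Real.Gamma_pos_of_pos (by linarith)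
  have f1 : (0:ℝ) < k.factorial := by exact_mod_cast Nat.factorial_pos k
  have hpi : 0 < √Real.pi := Real.sqrt_pos.mpr Real.pi_pos
  have hd := Real.Gamma_mul_Gamma_add_half (μ + k + 1/2)
  have e1 : μ + k + 1/2 + 1/2 = μ + k + 1 := by ring
  have e2 : 2 * (μ + k + 1/2) = 2 * μ + 2 * k + 1 := by ring
  have e3 : (2 * μ + 2 * k + 1 + 1) / 2 = μ + 1 + k := by ring
  have e4 : μ + 1 + k = μ + k + 1 := by ring
  have e5 : (2:ℝ) ^ (1 - (2 * μ + 2 * k + 1)) = (1 / 4) ^ (μ + k) := by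
    have : (1 / 4 : ℝ) = 2 ^ (-2 : ℝ) := by
      rw [Real.rpow_neg (by norm_num)]; norm_num
    rw [this, ← Real.rpow_mul (by norm_num)]; congr 1; ring
  rw [e1, e2, e5] at hd
  have e6 : Real.Gamma (μ + k + 1/2) =
      Real.Gamma (2 * μ + 2 * k + 1) * (1 / 4) ^ (μ + k) * √Real.pi / Real.Gamma (μ + k + 1) := by
    rw [eq_div_iff g2.ne', hd]
  rw [e6, e3, Real.rpow_add hx, Real.rpow_natCast, e4, neg_pow x k]
  unfold besQ
  field_simp

open MeasureTheory Set in
lemma bes_gauss {μ x : ℝ} (hμ : 0 < μ) (hx : 0 < x) :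
    ∫ t in Ioi (0:ℝ), t * besselJ μ t ^ 2 * Real.exp (-(t ^ 2 / x)) =
      x ^ (μ + 1) / (2 * √Real.pi * Real.Gamma (μ + 1/2)) *
      ∫ u in Ioo (0:ℝ) 1, Real.exp (-(x * u)) * (u ^ (μ - 1/2) * (1 - u) ^ (μ - 1/2)) := by
  set D := x ^ (μ + 1) / (2 * √Real.pi * Real.Gamma (μ + 1/2)) with hD
  have g3 : 0 < Real.Gamma (μ + 1/2) := Real.Gamma_pos_of_pos (by linarith)
  have hpi : 0 < √Real.pi := Real.sqrt_pos.mpr Real.pi_pos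
  have hDp : 0 < D := by positivity
  have hq : ∀ k : ℕ, (-1:ℝ) < 2 * μ + 2 * k + 1 := fun k => by
    have hk0 : (0:ℝ) ≤ k := Nat.cast_nonneg k
    linarith
  have hterm : ∀ k : ℕ, besQ μ k * (1 / 4) ^ (μ + k) *
      (∫ t in Ioi (0:ℝ), t ^ (2 * μ + 2 * k + 1) * Real.exp (-(1 / x) * t ^ (2:ℝ))) =
      D * ((-x) ^ k / k.factorial *
      ∫ u in Ioo (0:ℝ) 1, u ^ k * (u ^ (μ - 1/2) * (1 - u) ^ (μ - 1/2))) := by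
    intro k
    rw [(bes_moment (hq k) hx).2, (bes_beta_k hμ k).2, bes_coef hμ hx]
  have h := hasSum_integral_of_summable_integral_norm (μ := volume.restrict (Ioi (0:ℝ)))
    (F := fun (k : ℕ) t => besQ μ k * (1 / 4) ^ (μ + k) *
      (t ^ (2 * μ + 2 * k + 1) * Real.exp (-(1 / x) * t ^ (2:ℝ))))
    (fun k => (bes_moment (hq k) hx).1.const_mul _) (by
      have hb := (((Real.summable_pow_div_factorial x).mul_right
        (∫ u in Ioo (0:ℝ) 1, u ^ 0 * (u ^ (μ - 1/2) * (1 - u) ^ (μ - 1/2)))).mul_left D)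
      refine Summable.of_nonneg_of_le (fun k => integral_nonneg fun u => norm_nonneg _) ?_ hb
      intro k
      have : ∫ t in Ioi (0:ℝ), ‖besQ μ k * (1 / 4) ^ (μ + k) *
          (t ^ (2 * μ + 2 * k + 1) * Real.exp (-(1 / x) * t ^ (2:ℝ)))‖ =
          |besQ μ k * (1 / 4) ^ (μ + k) * ∫ t in Ioi (0:ℝ),
          (t ^ (2 * μ + 2 * k + 1) * Real.exp (-(1 / x) * t ^ (2:ℝ)))| := by
        rw [abs_mul, abs_of_nonneg (a := ∫ t in Ioi (0:ℝ), _), ← integral_const_mul]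
        · apply setIntegral_congr_fun measurableSet_Ioi
          intro t ht
          have ht : 0 < t := ht
          simp only
          rw [norm_mul, Real.norm_of_nonneg (r := t ^ _ * _) (by positivity), Real.norm_eq_abs]
        · apply setIntegral_nonneg measurableSet_Ioi
          intro t ht
          have ht : 0 < t := ht
          positivity
      rw [this, hterm, abs_mul, abs_of_pos hDp, abs_mul, abs_div, abs_pow, abs_neg, abs_of_pos hx,
        abs_of_nonneg (by positivity : (0:ℝ) ≤ k.factorial)]
      have h2 : 0 ≤ ∫ u in Ioo (0:ℝ) 1, u ^ k * (u ^ (μ - 1/2) * (1 - u) ^ (μ - 1/2)) := by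
        apply setIntegral_nonneg measurableSet_Ioo
        intro u hu
        have h0 := hu.1
        have h1 : 0 < 1 - u := by linarith [hu.2]
        positivity
      rw [abs_of_nonneg h2]
      have := bes_beta_le hμ k
      gcongr)
  have h3 : HasSum (fun k : ℕ => D * ((-x) ^ k / k.factorial *
      ∫ u in Ioo (0:ℝ) 1, u ^ k * (u ^ (μ - 1/2) * (1 - u) ^ (μ - 1/2)))) _ :=
    h.congr_fun (fun k => by rw [← hterm, integral_const_mul])
  have h4 := (bes_exp_beta hμ hx).mul_left D
  rw [← h3.unique h4]
  apply setIntegral_congr_fun measurableSet_Ioi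
  intro t ht
  have ht : 0 < t := ht
  simp only
  have h5 := (besE_sq hμ (t ^ 2 / 4)).mul_left (t * ((t / 2) ^ μ) ^ 2 * Real.exp (-(t ^ 2 / x)))
  have h6 : t * besselJ μ t ^ 2 * Real.exp (-(t ^ 2 / x)) =
      t * ((t / 2) ^ μ) ^ 2 * Real.exp (-(t ^ 2 / x)) * besE μ (t ^ 2 / 4) ^ 2 := by
    rw [besselJ_eq ht]; ring
  rw [h6, ← h5.tsum_eq]
  congr 1
  ext k
  have e1 : (1 / 4 : ℝ) ^ (μ + k) = (1 / 4) ^ μ * (1 / 4) ^ k := by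
    rw [Real.rpow_add (by norm_num), Real.rpow_natCast]
  have e2 : t ^ (2 * μ + 2 * k + 1) = (t ^ μ) ^ 2 * (t ^ 2) ^ k * t := by
    rw [Real.rpow_add_one ht.ne', Real.rpow_add ht, mul_comm 2 μ, Real.rpow_mul ht.le,
      mul_comm (2:ℝ) (k:ℝ), Real.rpow_mul ht.le, Real.rpow_natCast, Real.rpow_two, Real.rpow_two,
      ← pow_mul, ← pow_mul, mul_comm]
    ring
  have e3 : ((t / 2) ^ μ) ^ 2 = (t ^ μ) ^ 2 * (1 / 4) ^ μ := by
    have : (1 / 4 : ℝ) = (1 / 2) * (1 / 2) := by norm_num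
    rw [div_eq_mul_one_div t 2, Real.mul_rpow ht.le (by norm_num), this,
      Real.mul_rpow (by norm_num) (by norm_num)]
    ring
  have e4 : -(1 / x) * t ^ (2:ℝ) = -(t ^ 2 / x) := by
    rw [Real.rpow_two]; ring
  rw [e1, e2, e3, e4]
  ring

/-- everywhere defined measurable version of the Bessel function -/
def besT (μ t : ℝ) : ℝ := (t / 2) ^ μ * besE μ (t ^ 2 / 4)

lemma besT_measurable {μ : ℝ} (hμ : -1 < μ) : Measurable (besT μ) := by
  unfold besT
  have := (besE_continuous hμ).measurable
  fun_prop

lemma besT_continuous {μ : ℝ} (hμ : 0 ≤ μ) : Continuous (besT μ) := by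
  unfold besT
  have h1 := besE_continuous (show -1 < μ by linarith)
  have h2 : Continuous (fun t : ℝ => (t / 2) ^ μ) :=
    (continuous_id.div_const 2).rpow_const (fun x => Or.inr hμ)
  exact h2.mul (h1.comp (by fun_prop))

lemma besT_eq {μ t : ℝ} (ht : 0 < t) : besselJ μ t = besT μ t := besselJ_eq ht

open MeasureTheory Set in
lemma bes_lint {f : ℝ → ℝ} {s : Set ℝ} (hs : MeasurableSet s) (hf : IntegrableOn f s)
    (h0 : ∀ x ∈ s, 0 ≤ f x) :
    ∫⁻ x in s, ENNReal.ofReal (f x) = ENNReal.ofReal (∫ x in s, f x) := by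
  rw [ofReal_integral_eq_lintegral_ofReal hf]
  filter_upwards [ae_restrict_mem hs] with x hx using h0 x hx

open MeasureTheory Set in
lemma bes_expw {μ x : ℝ} (hμ : 0 < μ) (hx : 0 < x) :
    IntegrableOn (fun u : ℝ => Real.exp (-(x * u)) * (u ^ (μ - 1/2) * (1 - u) ^ (μ - 1/2)))
      (Ioo 0 1) ∧
    0 < ∫ u in Ioo (0:ℝ) 1, Real.exp (-(x * u)) * (u ^ (μ - 1/2) * (1 - u) ^ (μ - 1/2)) := by
  have h0 := bes_beta_k hμ 0
  simp only [pow_zero, one_mul] at h0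
  have hi : IntegrableOn (fun u : ℝ => Real.exp (-(x * u)) * (u ^ (μ - 1/2) * (1 - u) ^ (μ - 1/2)))
      (Ioo 0 1) := by
    refine Integrable.mono' h0.1 ?_ ?_
    · apply Measurable.aestronglyMeasurable; fun_prop
    · filter_upwards [ae_restrict_mem measurableSet_Ioo] with u hu
      have h1 := hu.1
      have h2 : 0 < 1 - u := by linarith [hu.2]
      rw [Real.norm_of_nonneg (by positivity)]
      have : Real.exp (-(x * u)) ≤ 1 := by
        rw [Real.exp_le_one_iff]; have := mul_pos hx h1; linarith
      have h3 : 0 ≤ u ^ (μ - 1/2) * (1 - u) ^ (μ - 1/2) := by positivity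
      exact mul_le_of_le_one_left h3 this
  refine ⟨hi, ?_⟩
  have g1 : 0 < Real.Gamma (2 * μ + (0:ℕ) + 1) := Real.Gamma_pos_of_pos (by simp; linarith)
  have g2 : 0 < Real.Gamma (μ + (0:ℕ) + 1/2) := Real.Gamma_pos_of_pos (by simp; linarith)
  have g3 : 0 < Real.Gamma (μ + 1/2) := Real.Gamma_pos_of_pos (by linarith)
  calc 0 < Real.exp (-x) * ∫ u in Ioo (0:ℝ) 1, (u ^ (μ - 1/2) * (1 - u) ^ (μ - 1/2)) := by
        rw [h0.2]; positivity
    _ = ∫ u in Ioo (0:ℝ) 1, Real.exp (-x) * (u ^ (μ - 1/2) * (1 - u) ^ (μ - 1/2)) := by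
        rw [integral_const_mul]
    _ ≤ _ := by
        apply setIntegral_mono_on (h0.1.const_mul _) hi measurableSet_Ioo
        intro u hu
        have h1 := hu.1
        have h2 : 0 < 1 - u := by linarith [hu.2]
        have : x * u ≤ x := by nlinarith [hu.2]
        gcongr

open MeasureTheory Set in
lemma bes_gauss_int {μ x : ℝ} (hμ : 0 < μ) (hx : 0 < x) :
    IntegrableOn (fun t : ℝ => t * besselJ μ t ^ 2 * Real.exp (-(t ^ 2 / x))) (Ioi 0) := by
  apply Integrable.of_integral_ne_zero
  rw [bes_gauss hμ hx]
  have := (bes_expw hμ hx).2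
  have g3 : 0 < Real.Gamma (μ + 1/2) := Real.Gamma_pos_of_pos (by linarith)
  have hpi : 0 < √Real.pi := Real.sqrt_pos.mpr Real.pi_pos
  positivity

open MeasureTheory Set in
lemma bes_inv {t : ℝ} (ht : 0 < t) :
    IntegrableOn (fun x : ℝ => x ^ (-2:ℝ) * Real.exp (-(t ^ 2 / x))) (Ioi 0) ∧
    ∫ x in Ioi (0:ℝ), x ^ (-2:ℝ) * Real.exp (-(t ^ 2 / x)) = 1 / t ^ 2 := by
  have h := integral_comp_rpow_Ioi (fun y : ℝ => Real.exp (-t ^ 2 * y)) (p := -1) (by norm_num)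
  rw [integral_exp_mul_Ioi (by simp; positivity)] at h
  have h2 : ∫ x in Ioi (0:ℝ), x ^ (-2:ℝ) * Real.exp (-(t ^ 2 / x)) = 1 / t ^ 2 := by
    rw [show (1 / t ^ 2 : ℝ) = -Real.exp (-t ^ 2 * 0) / -t ^ 2 by simp, ← h]
    apply setIntegral_congr_fun measurableSet_Ioi
    intro x hx
    simp only [smul_eq_mul, abs_neg, abs_one, one_mul]
    rw [Real.rpow_neg_one]
    norm_num
    left
    field_simp
  refine ⟨?_, h2⟩
  apply Integrable.of_integral_ne_zero
  rw [h2]; positivity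

open MeasureTheory Set in
lemma bes_sq_div {μ : ℝ} (hμ : 0 < μ) :
    IntegrableOn (fun t : ℝ => besselJ μ t ^ 2 / t) (Ioi 0) ∧
    ∫ t in Ioi (0:ℝ), besselJ μ t ^ 2 / t = 1 / (2 * μ) := by
  have g3 : 0 < Real.Gamma (μ + 1/2) := Real.Gamma_pos_of_pos (by linarith)
  have hpi : 0 < √Real.pi := Real.sqrt_pos.mpr Real.pi_pos
  have hmT := besT_measurable (show -1 < μ by linarith)
  set c : ℝ := 1 / (2 * √Real.pi * Real.Gamma (μ + 1/2)) with hc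
  have hcp : 0 < c := by positivity
  have key : ∫⁻ t in Ioi (0:ℝ), ENNReal.ofReal (besselJ μ t ^ 2 / t) =
      ENNReal.ofReal (1 / (2 * μ)) := by
    calc ∫⁻ t in Ioi (0:ℝ), ENNReal.ofReal (besselJ μ t ^ 2 / t)
        = ∫⁻ t in Ioi (0:ℝ), ∫⁻ x in Ioi (0:ℝ), ENNReal.ofReal
            (t * besT μ t ^ 2 * (x ^ (-2:ℝ) * Real.exp (-(t ^ 2 / x)))) := by
          apply setLIntegral_congr_fun measurableSet_Ioi
          intro t ht
          have ht : 0 < t := ht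
          simp only
          rw [bes_lint measurableSet_Ioi ((bes_inv ht).1.const_mul _), integral_const_mul,
            (bes_inv ht).2, besT_eq ht]
          · congr 1; field_simp
          · intro x hx
            have hx : 0 < x := hx
            positivity
      _ = ∫⁻ x in Ioi (0:ℝ), ∫⁻ t in Ioi (0:ℝ), ENNReal.ofReal
            (t * besT μ t ^ 2 * (x ^ (-2:ℝ) * Real.exp (-(t ^ 2 / x)))) := by
          apply lintegral_lintegral_swap
          apply Measurable.aemeasurable
          unfold Function.uncurry
          fun_prop
      _ = ∫⁻ x in Ioi (0:ℝ), ∫⁻ u in Ioo (0:ℝ) 1, ENNReal.ofReal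
            (c * (u ^ (μ - 1/2) * (1 - u) ^ (μ - 1/2)) *
              (x ^ (μ - 1) * Real.exp (-(u * x)))) := by
          apply setLIntegral_congr_fun measurableSet_Ioi
          intro x hx
          have hx : 0 < x := hx
          simp only
          have e1 : ∫⁻ t in Ioi (0:ℝ), ENNReal.ofReal
              (t * besT μ t ^ 2 * (x ^ (-2:ℝ) * Real.exp (-(t ^ 2 / x)))) =
              ∫⁻ t in Ioi (0:ℝ), ENNReal.ofReal
              (x ^ (-2:ℝ) * (t * besselJ μ t ^ 2 * Real.exp (-(t ^ 2 / x)))) := by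
            apply setLIntegral_congr_fun measurableSet_Ioi
            intro t ht
            have ht : 0 < t := ht
            simp only
            rw [besT_eq ht]; congr 1; ring
          have e2 : ∫⁻ u in Ioo (0:ℝ) 1, ENNReal.ofReal
              (c * (u ^ (μ - 1/2) * (1 - u) ^ (μ - 1/2)) *
              (x ^ (μ - 1) * Real.exp (-(u * x)))) =
              ∫⁻ u in Ioo (0:ℝ) 1, ENNReal.ofReal (c * x ^ (μ - 1) *
              (Real.exp (-(x * u)) * (u ^ (μ - 1/2) * (1 - u) ^ (μ - 1/2)))) := by
            congr 1; ext u; congr 1; rw [mul_comm u x]; ring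
          rw [e1, e2, bes_lint measurableSet_Ioi ((bes_gauss_int hμ hx).const_mul _),
            bes_lint measurableSet_Ioo ((bes_expw hμ hx).1.const_mul _), integral_const_mul,
            integral_const_mul, bes_gauss hμ hx]
          · congr 1
            have : x ^ (μ - 1) = x ^ (-2:ℝ) * x ^ (μ + 1) := by
              rw [← Real.rpow_add hx]; congr 1; ring
            rw [this, hc]; ring
          · intro u hu
            have h1 := hu.1
            have h2 : 0 < 1 - u := by linarith [hu.2]
            positivity
          · intro t ht
            have ht : 0 < t := ht
            positivity
      _ = ∫⁻ u in Ioo (0:ℝ) 1, ∫⁻ x in Ioi (0:ℝ), ENNReal.ofReal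
            (c * (u ^ (μ - 1/2) * (1 - u) ^ (μ - 1/2)) *
              (x ^ (μ - 1) * Real.exp (-(u * x)))) := by
          apply lintegral_lintegral_swap
          apply Measurable.aemeasurable
          unfold Function.uncurry
          fun_prop
      _ = ∫⁻ u in Ioo (0:ℝ) 1, ENNReal.ofReal (c * Real.Gamma μ *
            (u ^ ((1/2:ℝ) - 1) * (1 - u) ^ (μ + 1/2 - 1))) := by
          apply setLIntegral_congr_fun measurableSet_Ioo
          intro u hu
          have h1 := hu.1
          have h2 : 0 < 1 - u := by linarith [hu.2]
          have gm := Real.Gamma_pos_of_pos hμ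
          have hG := Real.integral_rpow_mul_exp_neg_mul_Ioi hμ h1
          have hGi : IntegrableOn (fun x : ℝ => x ^ (μ - 1) * Real.exp (-(u * x))) (Ioi 0) := by
            apply Integrable.of_integral_ne_zero
            rw [hG]; positivity
          simp only
          rw [bes_lint measurableSet_Ioi (hGi.const_mul _), integral_const_mul, hG]
          · congr 1
            have e1 : u ^ (μ - 1/2) * (1 / u) ^ μ = u ^ ((1/2:ℝ) - 1) := by
              rw [one_div u, Real.inv_rpow h1.le, ← Real.rpow_neg h1.le, ← Real.rpow_add h1]
              congr 1; ring
            have e2 : μ + 1/2 - 1 = μ - 1/2 := by ring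
            rw [← e1, e2]; ring
          · intro x hx
            have hx : 0 < x := hx
            positivity
      _ = ENNReal.ofReal (1 / (2 * μ)) := by
          have hb := bes_beta (α := 1/2) (β := μ + 1/2) (by norm_num) (by linarith)
          have gm := Real.Gamma_pos_of_pos hμ
          rw [bes_lint measurableSet_Ioo (hb.1.const_mul _), integral_const_mul, hb.2]
          · congr 1
            have e : 1/2 + (μ + 1/2) = μ + 1 := by ring
            rw [e, Real.Gamma_add_one hμ.ne', Real.Gamma_one_half_eq, hc]
            field_simp
          · intro u hu
            have h1 := hu.1
            have h2 : 0 < 1 - u := by linarith [hu.2]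
            positivity
  have hnn : 0 ≤ᵐ[volume.restrict (Ioi (0:ℝ))] fun t : ℝ => besselJ μ t ^ 2 / t := by
    filter_upwards [ae_restrict_mem measurableSet_Ioi] with t ht
    have ht : 0 < t := ht
    simp only [Pi.zero_apply]
    positivity
  have hms : AEStronglyMeasurable (fun t : ℝ => besselJ μ t ^ 2 / t)
      (volume.restrict (Ioi (0:ℝ))) := by
    have : Measurable (fun t : ℝ => besT μ t ^ 2 / t) := by fun_prop
    refine this.aestronglyMeasurable.congr ?_
    filter_upwards [ae_restrict_mem measurableSet_Ioi] with t ht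
    rw [besT_eq ht]
  refine ⟨?_, ?_⟩
  · rw [IntegrableOn, ← lintegral_ofReal_ne_top_iff_integrable hms hnn, key]
    exact ENNReal.ofReal_ne_top
  · rw [integral_eq_lintegral_of_nonneg_ae hnn hms, key, ENNReal.toReal_ofReal (by positivity)]

open MeasureTheory Set in
lemma bes_abel {M : ℝ → ℝ} {C : ℝ} (hM : Continuous M) (hC : Tendsto M atTop (nhds C)) :
    Tendsto (fun y : ℝ => y⁻¹ * ∫ t in Ioi 0, M t * Real.exp (-(t ^ 2 / y ^ 2))) atTop
      (nhds (C * (√Real.pi / 2))) := by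
  obtain ⟨B, hB⟩ : ∃ B, ∀ t, 0 ≤ t → |M t| ≤ B := by
    have h1 : ∀ᶠ t in atTop, |M t| ≤ |C| + 1 := by
      have := hC.abs.eventually (gt_mem_nhds (show |C| < |C| + 1 by linarith))
      filter_upwards [this] with t ht using ht.le
    obtain ⟨R, hR⟩ := eventually_atTop.mp h1
    obtain ⟨B, hB⟩ := (isCompact_Icc (a := (0:ℝ)) (b := R)).exists_bound_of_continuousOn
      hM.continuousOn
    refine ⟨max B (|C| + 1), fun t ht => ?_⟩
    rcases le_total t R with h | h
    · exact (hB t ⟨ht, h⟩).trans (le_max_left _ _)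
    · exact (hR t h).trans (le_max_right _ _)
  have key : Tendsto (fun y : ℝ => ∫ s in Ioi (0:ℝ), M (y * s) * Real.exp (-1 * s ^ 2)) atTop
      (nhds (∫ s in Ioi (0:ℝ), C * Real.exp (-1 * s ^ 2))) := by
    apply tendsto_integral_filter_of_dominated_convergence (fun s => B * Real.exp (-1 * s ^ 2))
    · filter_upwards with y
      apply Continuous.aestronglyMeasurable
      fun_prop
    · filter_upwards [eventually_gt_atTop 0] with y hy
      filter_upwards [ae_restrict_mem measurableSet_Ioi] with s hs
      have hs : 0 < s := hs
      rw [norm_mul, Real.norm_eq_abs, Real.norm_of_nonneg (Real.exp_pos _).le]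
      exact mul_le_mul_of_nonneg_right (hB _ (by positivity)) (Real.exp_pos _).le
    · exact ((integrable_exp_neg_mul_sq (b := 1) one_pos).const_mul B).integrableOn
    · filter_upwards [ae_restrict_mem measurableSet_Ioi] with s hs
      exact (hC.comp (tendsto_id.atTop_mul_const hs)).mul_const _
  rw [integral_const_mul, integral_gaussian_Ioi, div_one] at key
  refine key.congr' ?_
  filter_upwards [eventually_gt_atTop 0] with y hy
  have := integral_comp_mul_left_Ioi (fun t => M t * Real.exp (-(t ^ 2 / y ^ 2))) 0 hy
  rw [mul_zero, smul_eq_mul] at this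
  rw [← this]
  congr 1
  ext s
  congr 2
  field_simp

open MeasureTheory Set in
lemma bes_watson {p : ℝ} (hp : 0 < p) :
    Tendsto (fun x : ℝ => x ^ (p + 1) *
      ∫ u in Ioo (0:ℝ) 1, Real.exp (-(x * u)) * (u ^ p * (1 - u) ^ p)) atTop
      (nhds (Real.Gamma (p + 1))) := by
  have key : Tendsto (fun x : ℝ => ∫ v in Ioi (0:ℝ),
      Real.exp (-v) * v ^ (p + 1 - 1) * (max 0 (1 - v / x)) ^ p) atTop
      (nhds (∫ v in Ioi (0:ℝ), Real.exp (-v) * v ^ (p + 1 - 1))) := by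
    apply tendsto_integral_filter_of_dominated_convergence
      (fun v => Real.exp (-v) * v ^ (p + 1 - 1))
    · filter_upwards with x
      apply Measurable.aestronglyMeasurable
      fun_prop
    · filter_upwards [eventually_gt_atTop 0] with x hx
      filter_upwards [ae_restrict_mem measurableSet_Ioi] with v hv
      have hv : 0 < v := hv
      have h1 : 0 ≤ max 0 (1 - v / x) := le_max_left _ _
      rw [Real.norm_of_nonneg (by positivity)]
      apply mul_le_of_le_one_right (by positivity)
      apply Real.rpow_le_one h1 _ hp.le
      have : 0 < v / x := by positivity
      apply max_le <;> linarith
    · exact Real.GammaIntegral_convergent (by linarith)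
    · filter_upwards [ae_restrict_mem measurableSet_Ioi] with v hv
      have h1 : Tendsto (fun x : ℝ => max 0 (1 - v / x)) atTop (nhds 1) := by
        have : Tendsto (fun x : ℝ => v / x) atTop (nhds 0) := tendsto_const_nhds.div_atTop tendsto_id
        have h2 := (tendsto_const_nhds (x := (0:ℝ))).max ((tendsto_const_nhds (x := (1:ℝ))).sub this)
        simpa using h2
      have h3 := (h1.rpow_const (p := p) (Or.inr hp.le)).const_mul (Real.exp (-v) * v ^ (p + 1 - 1))
      simpa using h3
  rw [← Real.Gamma_eq_integral (by linarith)] at key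
  refine key.congr' ?_
  filter_upwards [eventually_gt_atTop 0] with x hx
  have h1 := integral_comp_mul_left_Ioi'
    (fun v => Real.exp (-v) * v ^ (p + 1 - 1) * (max 0 (1 - v / x)) ^ p) 0 hx
  rw [mul_zero, smul_eq_mul] at h1
  rw [← h1]
  rw [setIntegral_eq_of_subset_of_forall_sdiff_eq_zero (s := Ioo (0:ℝ) 1) measurableSet_Ioi
    (fun u hu => hu.1)]
  · rw [Real.rpow_add_one hx.ne', mul_comm (x ^ p) x, mul_assoc, ← integral_const_mul (x ^ p)]
    congr 1
    apply setIntegral_congr_fun measurableSet_Ioo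
    intro u hu
    have hu1 := hu.1
    have h2 : x * u / x = u := by field_simp
    have h3 : max 0 (1 - u) = 1 - u := max_eq_right (by linarith [hu.2])
    simp only [h2, h3, add_sub_cancel_right]
    rw [Real.mul_rpow hx.le hu1.le]
    ring
  · intro u hu
    have h0 : 0 < u := hu.1
    have h1 : 1 ≤ u := by
      by_contra h
      exact hu.2 ⟨h0, not_le.mp h⟩
    have h2 : x * u / x = u := by field_simp
    rw [h2, max_eq_left (by linarith), Real.zero_rpow hp.ne', mul_zero]

open MeasureTheory Set in
lemma bes_gauss_lim {μ : ℝ} (hμ : 1/2 < μ) :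
    Tendsto (fun y : ℝ => y⁻¹ * ∫ t in Ioi (0:ℝ),
      t * besselJ μ t ^ 2 * Real.exp (-(t ^ 2 / y ^ 2))) atTop (nhds (1 / (2 * √Real.pi))) := by
  have h := (bes_watson (p := μ - 1/2) (by linarith)).comp
    (tendsto_pow_atTop (α := ℝ) (n := 2) (by norm_num))
  have g3 : 0 < Real.Gamma (μ + 1/2) := Real.Gamma_pos_of_pos (by linarith)
  have hpi : 0 < √Real.pi := Real.sqrt_pos.mpr Real.pi_pos
  have e : μ - 1/2 + 1 = μ + 1/2 := by ring
  rw [e] at h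
  have h2 := h.const_mul (1 / (2 * √Real.pi * Real.Gamma (μ + 1/2)))
  have e2 : 1 / (2 * √Real.pi * Real.Gamma (μ + 1/2)) * Real.Gamma (μ + 1/2)
    = 1 / (2 * √Real.pi) := by field_simp
  rw [e2] at h2
  refine h2.congr' ?_
  filter_upwards [eventually_gt_atTop 0] with y hy
  have hy2 : 0 < y ^ 2 := by positivity
  rw [bes_gauss (by linarith) hy2]
  have e3 : (y ^ 2) ^ (μ + 1) = (y ^ 2) ^ (μ + 1/2) * y := by
    have : μ + 1 = (μ + 1/2) + 1/2 := by ring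
    rw [this, Real.rpow_add hy2, ← Real.sqrt_eq_rpow, Real.sqrt_sq hy.le]
  rw [e3]
  simp only [Function.comp]
  field_simp

open MeasureTheory Set in
lemma bes_const_big {μ C : ℝ} (hμ : 1/2 < μ)
    (hC : Tendsto (fun t => t * (besselJ μ t ^ 2 + besselJ (μ + 1) t ^ 2)) atTop (nhds C)) :
    C = 2 / Real.pi := by
  have c1 := besT_continuous (μ := μ) (by linarith)
  have c2 := besT_continuous (μ := μ + 1) (by linarith)
  have hC' : Tendsto (fun t => t * (besT μ t ^ 2 + besT (μ + 1) t ^ 2)) atTop (nhds C) := by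
    refine hC.congr' ?_
    filter_upwards [eventually_gt_atTop 0] with t ht
    rw [besT_eq ht, besT_eq ht]
  have h1 := bes_abel (by fun_prop) hC'
  have h2 := (bes_gauss_lim hμ).add (bes_gauss_lim (μ := μ + 1) (by linarith))
  have h3 : C * (√Real.pi / 2) = 1 / (2 * √Real.pi) + 1 / (2 * √Real.pi) := by
    refine tendsto_nhds_unique h1 (h2.congr' ?_)
    filter_upwards [eventually_gt_atTop 0] with y hy
    have hy2 : 0 < y ^ 2 := by positivity
    rw [← mul_add, ← integral_add (bes_gauss_int (by linarith) hy2)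
      (bes_gauss_int (by linarith) hy2)]
    congr 1
    apply setIntegral_congr_fun measurableSet_Ioi
    intro t ht
    simp only [besT_eq (μ := μ) ht, besT_eq (μ := μ + 1) ht]
    ring
  have hpi : 0 < √Real.pi := Real.sqrt_pos.mpr Real.pi_pos
  have hs : √Real.pi ^ 2 = Real.pi := Real.sq_sqrt Real.pi_pos.le
  rw [← hs]
  field_simp at h3 ⊢
  linarith

lemma bes_const_shift {μ C : ℝ} (hμ : -1 < μ)
    (hC : Tendsto (fun t => t * (besselJ μ t ^ 2 + besselJ (μ + 1) t ^ 2)) atTop (nhds C)) :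
    Tendsto (fun t => t * (besselJ (μ + 1) t ^ 2 + besselJ (μ + 1 + 1) t ^ 2)) atTop (nhds C) := by
  obtain ⟨_, _, _, h1, h2⟩ := bes_asymp (fun t ht => besselJ_hasDerivAt hμ ht)
    (fun t ht => besselJ_hasDerivAt' hμ ht)
  have h3 : Tendsto (fun t : ℝ => 4 * (μ + 1) ^ 2 * besselJ (μ + 1) t ^ 2 / t) atTop (nhds 0) :=
    ((h2.pow 2).const_mul _).div_atTop tendsto_id
  have h4 := (h1.mul h2).const_mul (4 * (μ + 1))
  have h5 := (hC.add h3).sub h4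
  have e : C + 0 - 4 * (μ + 1) * (0 * 0) = C := by ring
  rw [e] at h5
  refine h5.congr' ?_
  filter_upwards [eventually_gt_atTop 0] with t ht
  have hr := besselJ_rec (ν := μ + 1) (by linarith) ht
  rw [add_sub_cancel_right] at hr
  have : besselJ (μ + 1 + 1) t = 2 * (μ + 1) / t * besselJ (μ + 1) t - besselJ μ t := by linarith
  rw [this]
  field_simp
  ring

lemma bes_const {μ C : ℝ} (hμ : -1 < μ)
    (hC : Tendsto (fun t => t * (besselJ μ t ^ 2 + besselJ (μ + 1) t ^ 2)) atTop (nhds C)) :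
    C = 2 / Real.pi :=
  bes_const_big (by linarith)
    (bes_const_shift (by linarith) (bes_const_shift hμ hC))

/-- antiderivative of the integrand plus `ν (ν + 1) J_{ν+1}² / t` -/
def besF (ν t : ℝ) : ℝ :=
  (t ^ 2 * (besselJ ν t ^ 2 + besselJ (ν + 1) t ^ 2)
    - (2 * ν + 1) * (t * (besselJ ν t * besselJ (ν + 1) t))) / 2
    - ν * besselJ (ν + 1) t ^ 2 / 2 - t / Real.pi

lemma besF_hasDerivAt {ν t : ℝ} (hν : -1 < ν) (ht : 0 < t) :
    HasDerivAt (besF ν)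
      (t / 2 * (besselJ ν t ^ 2 - besselJ (ν + 1) t * besselJ (ν - 1) t) - 1 / Real.pi
        + ν * (ν + 1) * (besselJ (ν + 1) t ^ 2 / t)) t := by
  have ha := besselJ_hasDerivAt hν ht
  have hb := besselJ_hasDerivAt' hν ht
  rw [besselJ_rec hν ht]
  have h := (((((hasDerivAt_id t).pow 2).mul ((ha.pow 2).add (hb.pow 2))).sub
    (((hasDerivAt_id t).mul (ha.mul hb)).const_mul (2 * ν + 1))).div_const 2).sub
    (((hb.pow 2).const_mul ν).div_const 2) |>.sub ((hasDerivAt_id t).div_const Real.pi)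
  refine h.congr_deriv ?_
  simp
  field_simp
  ring

/-- the continuous extension of `besF` -/
def besG (ν t : ℝ) : ℝ :=
  (t / 2) ^ (2 * ν + 2) * (2 * (besE ν (t ^ 2 / 4) ^ 2
      + (t / 2) ^ 2 * besE (ν + 1) (t ^ 2 / 4) ^ 2)
    - (2 * ν + 1) * (besE ν (t ^ 2 / 4) * besE (ν + 1) (t ^ 2 / 4))
    - ν * besE (ν + 1) (t ^ 2 / 4) ^ 2 / 2) - t / Real.pi

lemma besG_continuous {ν : ℝ} (hν : -1 < ν) : Continuous (besG ν) := by
  have h1 := besE_continuous hν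
  have h2 := besE_continuous (show -1 < ν + 1 by linarith)
  have h3 : Continuous (fun t : ℝ => (t / 2) ^ (2 * ν + 2)) :=
    (continuous_id.div_const 2).rpow_const (fun x => Or.inr (by linarith))
  unfold besG
  fun_prop

lemma besF_eq {ν t : ℝ} (ht : 0 < t) : besF ν t = besG ν t := by
  have hs : 0 < t / 2 := by positivity
  unfold besF besG
  rw [besselJ_eq ht, besselJ_eq ht, Real.rpow_add_one hs.ne']
  have : (t / 2) ^ (2 * ν + 2) = ((t / 2) ^ ν) ^ 2 * (t / 2) ^ 2 := by
    have e : 2 * ν + 2 = ν * 2 + (2:ℕ) := by push_cast; ring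
    rw [e, Real.rpow_add_natCast hs.ne', Real.rpow_mul hs.le, Real.rpow_ofNat]
  rw [this]
  ring

open MeasureTheory Set in
lemma bes_intble {ν T : ℝ} (hν : -1 < ν) (hT : 0 < T) :
    IntervalIntegrable (fun t => t / 2 * (besselJ ν t ^ 2 - besselJ (ν + 1) t * besselJ (ν - 1) t)
      - 1 / Real.pi) volume 0 T := by
  have h1 := besE_continuous hν
  have h2 := besE_continuous (show -1 < ν + 1 by linarith)
  have h0 : IntervalIntegrable (fun t : ℝ => t ^ (2 * ν + 1)) volume 0 T :=
    intervalIntegral.intervalIntegrable_rpow' (by linarith)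
  have h3 := (h0.mul_continuousOn (g := fun t => (1 / 2 : ℝ) ^ (2 * ν + 1) *
    (besE ν (t ^ 2 / 4) ^ 2 + (t / 2) ^ 2 * besE (ν + 1) (t ^ 2 / 4) ^ 2
      - ν * (besE ν (t ^ 2 / 4) * besE (ν + 1) (t ^ 2 / 4)))) (by fun_prop)).sub
    (intervalIntegrable_const (c := 1 / Real.pi))
  refine h3.congr ?_
  intro t ht
  rw [uIoc_of_le hT.le] at ht
  have ht := ht.1
  have hs : 0 < t / 2 := by positivity
  simp only
  rw [besselJ_rec hν ht, besselJ_eq ht, besselJ_eq ht, Real.rpow_add_one hs.ne', ← mul_assoc,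
    ← Real.mul_rpow ht.le (by norm_num)]
  have : (t * (1 / 2)) ^ (2 * ν + 1) = ((t / 2) ^ ν) ^ 2 * (t / 2) := by
    have e : 2 * ν + 1 = ν * 2 + 1 := by ring
    rw [mul_one_div, e, Real.rpow_add_one hs.ne', Real.rpow_mul hs.le, Real.rpow_ofNat]
  rw [this]
  field_simp
  ring

open MeasureTheory Set in
theorem bes_main
    (ν : ℝ) (hν : -1 < ν) :
    Tendsto
      (fun T : ℝ => ∫ t in (0 : ℝ)..T,
        (t / 2 * ((besselJ ν t) ^ 2 - besselJ (ν + 1) t * besselJ (ν - 1) t) - 1 / Real.pi))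
      atTop (nhds (-ν / 2)) := by
  obtain ⟨C, hC, hlim, ha, hb⟩ := bes_asymp (fun t ht => besselJ_hasDerivAt hν ht)
    (fun t ht => besselJ_hasDerivAt' hν ht)
  obtain rfl := bes_const hν hC
  obtain ⟨hi, hv⟩ := bes_sq_div (μ := ν + 1) (by linarith)
  have hI := intervalIntegral_tendsto_integral_Ioi 0 hi tendsto_id
  rw [hv] at hI
  have hF : Tendsto (besF ν) atTop (nhds 0) := by
    have h := (hlim.div_const 2).sub (((hb.pow 2).const_mul ν).div_const 2)
    have e : (0:ℝ) / 2 - ν * 0 ^ 2 / 2 = 0 := by ring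
    rw [e] at h
    refine h.congr ?_
    intro t
    unfold besF
    ring
  have h := hF.sub (hI.const_mul (ν * (ν + 1)))
  have e : 0 - ν * (ν + 1) * (1 / (2 * (ν + 1))) = -ν / 2 := by
    have : ν + 1 ≠ 0 := by linarith
    field_simp
    ring
  rw [e] at h
  refine h.congr' ?_
  filter_upwards [eventually_gt_atTop 0] with T hT
  have hi2 : IntervalIntegrable (fun t => besselJ (ν + 1) t ^ 2 / t) volume 0 T := by
    rw [intervalIntegrable_iff_integrableOn_Ioc_of_le hT.le]
    exact hi.mono_set (fun x hx => hx.1)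
  have hi1 := bes_intble hν hT
  have hG := besG_continuous hν
  have hG0 : besG ν 0 = 0 := by
    unfold besG
    rw [zero_div, Real.zero_rpow (by linarith)]
    simp
  have l0 : Tendsto (besF ν) (nhdsWithin 0 (Ioi 0)) (nhds 0) := by
    have := (hG.tendsto 0).mono_left (nhdsWithin_le_nhds (s := Ioi 0))
    rw [hG0] at this
    refine this.congr' ?_
    filter_upwards [self_mem_nhdsWithin] with t ht using (besF_eq ht).symm
  have l1 : Tendsto (besF ν) (nhdsWithin T (Iio T)) (nhds (besF ν T)) :=
    (besF_hasDerivAt hν hT).continuousAt.tendsto.mono_left nhdsWithin_le_nhds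
  have key := intervalIntegral.integral_eq_sub_of_hasDerivAt_of_tendsto hT
    (fun t ht => besF_hasDerivAt hν ht.1) (hi1.add (hi2.const_mul _)) l0 l1
  rw [intervalIntegral.integral_add hi1 (hi2.const_mul _),
    intervalIntegral.integral_const_mul] at key
  simp only [id]
  linarith

/-- For `ν > -1`,
`∫_0^∞ ((t/2)(J_ν²(t) - J_{ν+1}(t)J_{ν-1}(t)) - 1/π) dt = -ν/2`,
as an improper Riemann integral. -/
theorem integral_besselJ_diagonal_correction
    (ν : ℝ) (hν : -1 < ν) :
    Tendsto
      (fun T : ℝ => ∫ t in (0 : ℝ)..T,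
        (t / 2 * ((besselJ ν t) ^ 2 - besselJ (ν + 1) t * besselJ (ν - 1) t) - 1 / Real.pi))
      atTop (nhds (-ν / 2)) := bes_main ν hν

end
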